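/- arXiv:1304.3340 — 4 statements merged into one kernel-verified Lean document; each statement's English description precedes it below -/
import Mathlib

section
/- For every real number n ≥ 0, setting b = n²/(1+2n) and a = n − b, one has a ≥ 0, b ≥ 0, a + b = n, and 2·a·(2b + 1 + 2·√(b·(1+b))) = 2·n·(1+n). (Hence the bound W(0) ≥ (2/π)·exp(−2n(1+n)) for pure Gaussian states is tight: at fixed mean photon number n it is saturated by choosing the squeezing photon number n_s = n²/(1+2n).) -/
/-- Tightness of the bound `W(0) ≥ (2/π)·exp(−2n(1+n))`: for every mean photon
number `n ≥ 0`, choosing squeezing photon number `b = n²/(1+2n)` and displacement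
photon number `a = n − b` saturates the optimization, i.e.
`2·a·(2b + 1 + 2√(b(1+b))) = 2·n·(1+n)`. -/
theorem wigner_exponent_bound_tight (n : ℝ) (hn : 0 ≤ n) :
    0 ≤ n - n ^ 2 / (1 + 2 * n) ∧ 0 ≤ n ^ 2 / (1 + 2 * n) ∧
    (n - n ^ 2 / (1 + 2 * n)) + n ^ 2 / (1 + 2 * n) = n ∧
    2 * (n - n ^ 2 / (1 + 2 * n)) *
      (2 * (n ^ 2 / (1 + 2 * n)) + 1 +
        2 * Real.sqrt ((n ^ 2 / (1 + 2 * n)) * (1 + n ^ 2 / (1 + 2 * n)))) =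
      2 * n * (1 + n) := by
  have hpos : 0 < 1 + 2 * n := by positivity
  have ha : n - n ^ 2 / (1 + 2 * n) = n * (1 + n) / (1 + 2 * n) := by
    field_simp
    ring
  have hsqrt : Real.sqrt ((n ^ 2 / (1 + 2 * n)) * (1 + n ^ 2 / (1 + 2 * n))) =
      n * (1 + n) / (1 + 2 * n) := by
    rw [Real.sqrt_eq_iff_mul_self_eq (by positivity) (by positivity)]
    field_simp
    ring
  refine ⟨ha ▸ by positivity, by positivity, sub_add_cancel _ _, ?_⟩
  rw [hsqrt, ha]
  field_simp
  ring
end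

section
/- For every real ε with 0 ≤ ε < 1, one has 2ε − 1 < exp(−2·(1−ε)·(2−ε)). (Hence the non-Gaussianity indicator Δ₁ of the single-photon Fock state |1⟩ after a loss channel of parameter ε is strictly negative, so the lossy single-photon state is detected as quantum non-Gaussian by Criterion 1 for every loss parameter ε < 1.) -/
/-- The logarithm series truncated after its quadratic term strictly bounds `log (1 - x)`. -/
theorem log_one_sub_lt_neg_sub_sq_half {x : ℝ} (hx0 : 0 < x) (hx1 : x < 1) :
    Real.log (1 - x) < -x - x ^ 2 / 2 := by
  have hs := Real.hasSum_pow_div_log_of_abs_lt_one (abs_lt.2 ⟨by linarith, hx1⟩)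
  have h := sum_le_hasSum (Finset.range 3) (fun i _ => by positivity) hs
  norm_num [Finset.sum_range_succ] at h
  have h3 : 0 < x ^ 3 / 3 := by positivity
  linarith


/-- For every loss parameter `0 ≤ ε < 1`, `2ε − 1 < exp(−2(1−ε)(2−ε))`; hence
the non-Gaussianity indicator `Δ₁` of the single-photon Fock state `|1⟩` after a
loss channel of parameter `ε` is strictly negative, so the lossy single photon
is detected as quantum non-Gaussian by Criterion 1 for every `ε < 1`. -/
theorem lossy_single_photon_quantum_nonGaussian (ε : ℝ) (h0 : 0 ≤ ε) (h1 : ε < 1) :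
    2 * ε - 1 < Real.exp (-2 * (1 - ε) * (2 - ε)) := by
  rcases le_or_gt (2 * ε - 1) 0 with h | h
  · exact h.trans_lt (Real.exp_pos _)
  · rw [← Real.log_lt_iff_lt_exp h]
    have hlog := log_one_sub_lt_neg_sub_sq_half (x := 2 * (1 - ε)) (by linarith) (by linarith)
    convert hlog using 1
    · ring_nf
    · ring
end

section
/- For every integer m ≥ 1 there exists a real ε with 1/2 < ε < 1 such that (2ε−1)^m < exp(−2·m·(1−ε)·(1 + m·(1−ε))). (Hence for every Fock state |m⟩, Criterion 1 detects quantum non-Gaussianity of the lossy state for some loss parameter ε strictly greater than 1/2, i.e. in the regime where the Wigner function of the evolved state is everywhere positive.) -/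
/-- For every Fock state `|m⟩` with `m ≥ 1`, Criterion 1 detects quantum
non-Gaussianity of the lossy state for some loss parameter `ε` strictly greater
than `1/2` (where the evolved Wigner function is everywhere positive):
there exists `1/2 < ε < 1` with `(2ε−1)^m < exp(−2m(1−ε)(1 + m(1−ε)))`. -/
theorem lossy_fock_quantum_nonGaussian_beyond_half (m : ℕ) (hm : 1 ≤ m) :
    ∃ ε : ℝ, 1 / 2 < ε ∧ ε < 1 ∧
      (2 * ε - 1) ^ m <
        Real.exp (-2 * (m : ℝ) * (1 - ε) * (1 + (m : ℝ) * (1 - ε))) := by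
  have hcont : ∀ᶠ ε : ℝ in nhds (1 / 2), (2 * ε - 1) ^ m <
      Real.exp (-2 * (m : ℝ) * (1 - ε) * (1 + (m : ℝ) * (1 - ε))) := by
    refine ContinuousAt.eventually_lt (by fun_prop) (by fun_prop) ?_
    have h0 : (2 * (1 / 2 : ℝ) - 1) ^ m = 0 := by
      rw [show 2 * (1 / 2 : ℝ) - 1 = 0 by norm_num, zero_pow (by omega)]
    rw [h0]
    exact Real.exp_pos _
  have hIoo : ∀ᶠ ε : ℝ in nhdsWithin (1 / 2) (Set.Ioi (1 / 2)), ε ∈ Set.Ioo (1 / 2 : ℝ) 1 :=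
    Ioo_mem_nhdsGT (by norm_num)
  obtain ⟨ε, ⟨hε₁, hε₂⟩, hε⟩ := (hIoo.and (hcont.filter_mono nhdsWithin_le_nhds)).exists
  exact ⟨ε, hε₁, hε₂, hε⟩
end

section
/- Let r > 0 and 0 < ε < 1, and define h : ℝ → ℝ by h(s) = (1−ε)·((3·sinh²r + 1)·cosh(2s) + 3·sinh r·cosh r·sinh(2s)) + sinh²s. Then h attains its global minimum at the unique point s_opt = −arccosh(μ_opt), where μ_opt = (1/√2)·(1 + (6·(1−ε)·cosh²r + 4ε − 3)/√((4ε−3)² + 12·(1−ε)·ε·cosh²r))^{1/2}. (This is the paper's closed-form expression for the optimal squeezing parameter minimizing the mean photon number of a lossy photon-subtracted squeezed state in Criterion 2.) -/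
open Real

/-- The inverse hyperbolic cosine, `arccosh x = log(x + √(x² − 1))`. -/
noncomputable def arccosh (x : ℝ) : ℝ := Real.log (x + Real.sqrt (x ^ 2 - 1))

/-- The optimal point `-arcosh μ` has `cosh (2 · arcosh μ) = a / √(a² − b²)` and
`sinh (2 · arcosh μ) = b / √(a² − b²)`, so a hyperbolic combination collapses to one `cosh`. -/
theorem hyperbolic_combination_eq {a b q μ : ℝ} (hb : 0 ≤ b) (hq : 0 < q) (ha : 0 ≤ a)
    (hqab : q ^ 2 = a ^ 2 - b ^ 2) (hμ0 : 0 ≤ μ) (hμ : μ ^ 2 = (1 + a / q) / 2) (s : ℝ) :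
    a * cosh (2 * s) + b * sinh (2 * s) = q * cosh (2 * (s - -arcosh μ)) := by
  have hqa : q ≤ a := by nlinarith
  have haq : 1 ≤ a / q := (one_le_div hq).2 hqa
  have hμ1 : 1 ≤ μ := by nlinarith
  have hsq : sinh (arcosh μ) ^ 2 = μ ^ 2 - 1 := by
    rw [sinh_sq, cosh_arcosh hμ1]
  have hc : cosh (2 * arcosh μ) = a / q := by
    rw [cosh_two_mul, hsq, cosh_arcosh hμ1, hμ]
    ring
  have hs : sinh (2 * arcosh μ) = b / q := by
    have h0 : 0 ≤ sinh (2 * arcosh μ) :=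
      sinh_nonneg_iff.2 (mul_nonneg zero_le_two (arcosh_nonneg hμ1))
    rw [← sq_eq_sq₀ h0 (by positivity), sinh_sq, hc]
    field_simp
    linarith
  rw [sub_neg_eq_add, mul_add, cosh_add, hc, hs]
  field_simp

/-- `√2⁻¹ · √x` squares to `x / 2` for `x ≥ 0`. -/
theorem inv_sqrt_two_mul_sqrt_sq {x : ℝ} (hx : 0 ≤ x) : (1 / √2 * √x) ^ 2 = x / 2 := by
  rw [mul_pow, div_pow, sq_sqrt zero_le_two, sq_sqrt hx]
  ring

/-- Closed-form optimal squeezing parameter in Criterion 2 for a lossy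
photon-subtracted squeezed state: for `r > 0` and `0 < ε < 1`, the mean photon
number `h(s) = (1−ε)·((3 sinh²r + 1)·cosh 2s + 3 sinh r cosh r·sinh 2s) + sinh²s`
of the state after an extra squeezing `S(s)` attains its global minimum at the
unique point `s_opt = −arccosh μ_opt`, where
`μ_opt = (1/√2)·(1 + (6(1−ε)cosh²r + 4ε − 3)/√((4ε−3)² + 12(1−ε)ε cosh²r))^{1/2}`. -/
theorem pss_optimal_squeezing (r ε : ℝ) (hr : 0 < r) (hε0 : 0 < ε) (hε1 : ε < 1) :
    let h : ℝ → ℝ := fun s =>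
      (1 - ε) * ((3 * Real.sinh r ^ 2 + 1) * Real.cosh (2 * s) +
        3 * Real.sinh r * Real.cosh r * Real.sinh (2 * s)) + Real.sinh s ^ 2
    let μopt : ℝ := (1 / Real.sqrt 2) *
      Real.sqrt (1 + (6 * (1 - ε) * Real.cosh r ^ 2 + 4 * ε - 3) /
        Real.sqrt ((4 * ε - 3) ^ 2 + 12 * (1 - ε) * ε * Real.cosh r ^ 2))
    let sopt : ℝ := -arccosh μopt
    (∀ s : ℝ, h sopt ≤ h s) ∧ (∀ s : ℝ, h s = h sopt → s = sopt) := by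
  intro h μopt sopt
  set c := cosh r with hc
  have hs2 : sinh r ^ 2 = c ^ 2 - 1 := sinh_sq r
  have hs : 0 < sinh r := sinh_pos_iff.2 hr
  have hc1 : 1 ≤ c := one_le_cosh r
  have hε : 0 < 1 - ε := sub_pos.2 hε1
  set a := 6 * (1 - ε) * c ^ 2 + 4 * ε - 3 with ha_def
  set Q := (4 * ε - 3) ^ 2 + 12 * (1 - ε) * ε * c ^ 2
  have ha : 0 ≤ a := by nlinarith
  have hQ : 0 < Q := by positivity
  have hq : 0 < √Q := sqrt_pos.2 hQ
  have key : ∀ s, h s = √Q / 2 * cosh (2 * (s - sopt)) - 1 / 2 := by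
    intro s
    have e := hyperbolic_combination_eq (b := 6 * (1 - ε) * sinh r * c) (q := √Q) (μ := μopt)
      (by positivity) hq ha
      (by rw [sq_sqrt hQ.le, mul_pow, mul_pow, hs2]; ring)
      (by positivity) (inv_sqrt_two_mul_sqrt_sq (by positivity)) s
    change _ = √Q * cosh (2 * (s - sopt)) at e
    have hs_half : sinh s ^ 2 = (cosh (2 * s) - 1) / 2 := by
      rw [cosh_two_mul, cosh_sq]
      ring
    simp only [h]
    rw [hs_half, hs2]
    linear_combination e / 2
  have key_opt : h sopt = √Q / 2 - 1 / 2 := by simp [key]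
  refine ⟨fun s => ?_, fun s hs_eq => ?_⟩
  · rw [key_opt, key s]
    nlinarith [one_le_cosh (2 * (s - sopt))]
  · rw [key_opt, key s] at hs_eq
    have h1 : cosh (2 * (s - sopt)) = 1 :=
      mul_left_cancel₀ (half_pos hq).ne' (by linarith)
    by_contra hne
    have hne' : 2 * (s - sopt) ≠ 0 := mul_ne_zero two_ne_zero (sub_ne_zero.2 hne)
    exact (one_lt_cosh.2 hne').ne' h1
end
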